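/- arXiv:quant-ph/0501056 — 4 statements merged into one kernel-verified Lean document; each statement's English description precedes it below -/
import Mathlib

section
/- Let G be a finite group and ρ : G → U(V) a unitary representation on a finite-dimensional complex inner product space V. Equip End(V) with the Frobenius inner product ⟨A,B⟩ = tr(A†B), and let G act on End(V) by the conjugation representation g·A = ρ(g) A ρ(g)⁻¹ (which realizes ρ ⊗ ρ*). Let [m] be a conjugacy class of G consisting of involutions. Then for every b ∈ V, the expectation of |⟨b, ρ(m)b⟩|² over m chosen uniformly from [m] equals Σ_σ (χ_σ([m])/d_σ)·‖Π_σ(|b⟩⟨b|)‖², where the sum runs over the irreducible characters σ of G, |b⟩⟨b| is the rank-one operator v ↦ ⟨b,v⟩b, and Π_σ is the orthogonal projection of End(V) onto the σ-isotypic component of the conjugation representation. -/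
open scoped InnerProductSpace

/-- The rank-one operator `|b⟩⟨b| : v ↦ ⟨b,v⟩·b`. -/
noncomputable def outerSelf {V : Type*} [NormedAddCommGroup V] [InnerProductSpace ℂ V]
    (b : V) : V →ₗ[ℂ] V :=
  (innerₛₗ ℂ b).smulRight b

/-- The Frobenius inner product `⟨A,B⟩ = tr(A†B)` on `End(V)`. -/
noncomputable def frobInner {V : Type*} [NormedAddCommGroup V] [InnerProductSpace ℂ V]
    [FiniteDimensional ℂ V] (A B : V →ₗ[ℂ] V) : ℂ :=
  LinearMap.trace ℂ V (LinearMap.adjoint A ∘ₗ B)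

/-- The conjugation action of `g ∈ G` on `End(V)`: `A ↦ ρ(g) A ρ(g)⁻¹`.
This realizes the representation `ρ ⊗ ρ*`. -/
noncomputable def conjEnd {G V : Type*} [Group G] [NormedAddCommGroup V]
    [InnerProductSpace ℂ V] (ρ : G →* (V ≃ₗᵢ[ℂ] V)) (g : G) (A : V →ₗ[ℂ] V) :
    V →ₗ[ℂ] V :=
  ((ρ g).toLinearEquiv : V →ₗ[ℂ] V) ∘ₗ A ∘ₗ ((ρ g⁻¹).toLinearEquiv : V →ₗ[ℂ] V)

/-- `f : G → ℂ` is an irreducible character of `G`. -/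
def IsIrreducibleCharacter (G : Type) [Group G] (f : G → ℂ) : Prop :=
  ∃ W : FDRep ℂ G, CategoryTheory.Simple W ∧ ∀ g : G, W.character g = f g

/-- The `σ`-isotypic orthogonal projection `Π_σ = (d_σ/|G|) Σ_{g∈G} χ_σ(g)* (g·)` of the
conjugation representation of `G` on `End(V)`, applied to `A`; here `f = χ_σ` and
`d_σ = f 1`. -/
noncomputable def isotypicProjEnd {G V : Type*} [Group G] [Fintype G] [NormedAddCommGroup V]
    [InnerProductSpace ℂ V] (ρ : G →* (V ≃ₗᵢ[ℂ] V)) (f : G → ℂ) (A : V →ₗ[ℂ] V) :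
    V →ₗ[ℂ] V :=
  (f 1 / (Nat.card G : ℂ)) • ∑ g : G, (starRingEnd ℂ (f g)) • conjEnd ρ g A

open scoped ComplexOrder in
theorem Representation.conj_character {G W : Type*} [Group G] [Fintype G] [AddCommGroup W]
    [Module ℂ W] [FiniteDimensional ℂ W] (ρ : Representation ℂ G W) (g : G) :
    starRingEnd ℂ (ρ.character g) = ρ.character g⁻¹ := by
  classical
  let B := Module.finBasis ℂ W
  let R : G → Matrix _ _ ℂ := fun g => LinearMap.toMatrix B B (ρ g)
  have hmul : ∀ x y, R (x * y) = R x * R y := fun x y => by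
    simp only [R, map_mul, LinearMap.toMatrix_mul]
  have hone : R 1 = 1 := by simp only [R, map_one, LinearMap.toMatrix_one]
  have htr : ∀ x, ρ.character x = (R x).trace := fun x =>
    LinearMap.trace_eq_matrix_trace ℂ B (ρ x)
  let H : Matrix _ _ ℂ := ∑ x, (R x).conjTranspose * R x
  have hH : IsUnit H := by
    refine Matrix.PosDef.isUnit ?_
    have : H = (1 : Matrix _ _ ℂ) + ∑ x ∈ Finset.univ.erase 1, (R x).conjTranspose * R x := by
      change ∑ x, (R x).conjTranspose * R x = _
      rw [← Finset.add_sum_erase Finset.univ _ (Finset.mem_univ 1)]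
      simp [hone]
    rw [this]
    exact Matrix.PosDef.one.add_posSemidef
      (Matrix.posSemidef_sum _ fun x _ => Matrix.posSemidef_conjTranspose_mul_self _)
  have hinv : (R g).conjTranspose * H * R g = H := by
    simp only [H, Finset.mul_sum, Finset.sum_mul]
    refine Fintype.sum_equiv (Equiv.mulRight g) _ _ fun x => ?_
    simp [hmul, Matrix.conjTranspose_mul, Matrix.mul_assoc]
  have hgg : R g * R g⁻¹ = 1 := by rw [← hmul, mul_inv_cancel, hone]
  have hcomm : (R g).conjTranspose * H = H * R g⁻¹ := by
    rw [← hinv, Matrix.mul_assoc _ (R g), hgg, Matrix.mul_one, hinv]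
  have hdet : IsUnit H.det := (Matrix.isUnit_iff_isUnit_det H).1 hH
  rw [htr, htr, starRingEnd_apply, ← Matrix.trace_conjTranspose,
    ← Matrix.mul_nonsing_inv_cancel_right H (R g).conjTranspose hdet, hcomm, Matrix.trace_mul_comm,
    Matrix.nonsing_inv_mul_cancel_left H _ hdet]

theorem Representation.eq_smul_one_of_commute {G W : Type*} [Group G] [Fintype G] [AddCommGroup W]
    [Module ℂ W] [FiniteDimensional ℂ W] (ρ : Representation ℂ G W)
    (hρ : ∑ g, ρ.character g * ρ.character g⁻¹ = Nat.card G)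
    (T : W →ₗ[ℂ] W) (hT : ∀ g, T ∘ₗ ρ g = ρ g ∘ₗ T) : ∃ c : ℂ, T = c • LinearMap.id := by
  have hG : (Nat.card G : ℂ) ≠ 0 := Nat.cast_ne_zero.2 Nat.card_pos.ne'
  have := invertibleOfNonzero hG
  have h := ρ.card_inv_mul_sum_char_mul_char_eq_finrank ρ
  rw [hρ, inv_mul_cancel₀ hG] at h
  obtain ⟨v, hv, hspan⟩ := finrank_eq_one_iff'.1 (by exact_mod_cast h.symm :
    Module.finrank ℂ (Representation.IntertwiningMap ρ ρ) = 1)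
  obtain ⟨a, ha⟩ := hspan (Representation.IntertwiningMap.id ρ)
  obtain ⟨c, hc⟩ := hspan ⟨T, fun g => hT g⟩
  have ha' : ∀ x, a • v x = x := fun x => by
    simpa using DFunLike.congr_fun ha x
  have hc' : ∀ x, c • v x = T x := fun x => DFunLike.congr_fun hc x
  have ha0 : a ≠ 0 := by
    rintro rfl
    refine hv (DFunLike.ext _ _ fun x => ?_)
    rw [← ha' (v x), zero_smul]
    rfl
  refine ⟨c / a, LinearMap.ext fun x => ?_⟩
  rw [← hc', LinearMap.smul_apply, LinearMap.id_apply]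
  nth_rw 2 [← ha' x]
  rw [smul_smul, div_mul_cancel₀ c ha0]

theorem Representation.sum_smul_eq_smul_one {G W : Type*} [Group G] [Fintype G] [AddCommGroup W]
    [Module ℂ W] [FiniteDimensional ℂ W] (ρ : Representation ℂ G W)
    (hρ : ∑ g, ρ.character g * ρ.character g⁻¹ = Nat.card G)
    (h : G → ℂ) (hh : ∀ x g, h (x * g * x⁻¹) = h g) :
    ∃ c : ℂ, ∑ g, h g • ρ g = c • LinearMap.id ∧
      c * ρ.character 1 = ∑ g, h g * ρ.character g := by
  obtain ⟨c, hc⟩ := Representation.eq_smul_one_of_commute ρ hρ (∑ g, h g • ρ g) fun x => by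
    change (∑ g, h g • ρ g) * ρ x = ρ x * ∑ g, h g • ρ g
    rw [Finset.sum_mul, Finset.mul_sum]
    refine Fintype.sum_equiv (MulAut.conj x⁻¹).toEquiv _ _ fun g => ?_
    have : h (x⁻¹ * g * x) = h g := by simpa using hh x⁻¹ g
    simp only [smul_mul_assoc, mul_smul_comm, ← map_mul, MulEquiv.toEquiv_eq_coe, EquivLike.coe_coe,
      MulAut.conj_apply, inv_inv, mul_assoc, mul_inv_cancel_left]
    rw [← mul_assoc, this]
  refine ⟨c, hc, ?_⟩
  have := congrArg (LinearMap.trace ℂ W) hc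
  simp only [map_sum, map_smul, smul_eq_mul] at this
  simp [Representation.character, this]

theorem isIrreducibleCharacter_of_isIrreducible {G W : Type} [Group G] [Fintype G]
    [AddCommGroup W] [Module ℂ W] [FiniteDimensional ℂ W] (ρ : Representation ℂ G W)
    [ρ.IsIrreducible] : IsIrreducibleCharacter G ρ.character := by
  have hG : (Nat.card G : ℂ) ≠ 0 := Nat.cast_ne_zero.2 Nat.card_pos.ne'
  have := invertibleOfNonzero hG
  refine ⟨FDRep.of ρ, ?_, fun g => rfl⟩
  rw [FDRep.simple_iff_char_is_norm_one]
  have h := Representation.char_orthonormal ρ ρ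
  rw [if_pos ⟨Representation.Equiv.refl ρ⟩, inv_mul_eq_one₀ hG] at h
  exact h.symm

namespace IsIrreducibleCharacter

variable {G : Type} [Group G] {f : G → ℂ}

theorem exists_representation [Fintype G] (hf : IsIrreducibleCharacter G f) :
    ∃ W : FDRep ℂ G, CategoryTheory.Simple W ∧ f = Representation.character W.ρ ∧
      ∑ g, Representation.character W.ρ g * Representation.character W.ρ g⁻¹ = Nat.card G := by
  obtain ⟨W, hW, h⟩ := hf
  exact ⟨W, hW, funext fun g => (h g).symm, (FDRep.simple_iff_char_is_norm_one W).1 hW⟩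

theorem conj_apply [Fintype G] (hf : IsIrreducibleCharacter G f) (g : G) :
    starRingEnd ℂ (f g) = f g⁻¹ := by
  obtain ⟨W, -, rfl, -⟩ := hf.exists_representation
  exact Representation.conj_character W.ρ g

theorem map_conj [Fintype G] (hf : IsIrreducibleCharacter G f) (x g : G) :
    f (x * g * x⁻¹) = f g := by
  obtain ⟨W, -, rfl, -⟩ := hf.exists_representation
  exact Representation.char_conj W.ρ g x

theorem sum_mul_inv_self [Fintype G] (hf : IsIrreducibleCharacter G f) :
    ∑ g, f g * f g⁻¹ = Nat.card G := by
  obtain ⟨W, -, rfl, h⟩ := hf.exists_representation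
  exact h

theorem sum_mul_inv_of_ne [Fintype G] (hf : IsIrreducibleCharacter G f) {f' : G → ℂ}
    (hf' : IsIrreducibleCharacter G f') (hne : f ≠ f') : ∑ g, f g * f' g⁻¹ = 0 := by
  have hG : (Nat.card G : ℂ) ≠ 0 := Nat.cast_ne_zero.2 Nat.card_pos.ne'
  have := invertibleOfNonzero hG
  obtain ⟨W, hW, rfl, -⟩ := hf.exists_representation
  obtain ⟨W', hW', rfl, -⟩ := hf'.exists_representation
  have h := FDRep.char_orthonormal W W'
  rw [if_neg fun ⟨i⟩ => hne (FDRep.char_iso i)] at h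
  exact (mul_eq_zero.1 h).resolve_left (inv_ne_zero hG)

theorem apply_one_mul_sum [Fintype G] (hf : IsIrreducibleCharacter G f) (k : G) :
    f 1 * ∑ g, f g * f (k * g⁻¹) = Nat.card G * f k := by
  obtain ⟨W, -, rfl, h⟩ := hf.exists_representation
  obtain ⟨c, hc, hc1⟩ := Representation.sum_smul_eq_smul_one W.ρ h
    (fun g => Representation.character W.ρ g⁻¹) fun x g => by
      rw [← Representation.char_conj W.ρ g⁻¹ x]
      simp only [mul_inv_rev, inv_inv, mul_assoc]
  have hsum : ∑ g, Representation.character W.ρ g * Representation.character W.ρ (k * g⁻¹) =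
      c * Representation.character W.ρ k := by
    have := congrArg (fun T => LinearMap.trace ℂ W (W.ρ k * T)) hc
    simp only [Finset.mul_sum, mul_smul_comm, ← map_mul, map_sum, map_smul, smul_eq_mul] at this
    rw [← Equiv.sum_comp (Equiv.inv G)]
    simpa [Representation.character, ← Module.End.one_eq_id] using this
  simp only [mul_comm (Representation.character W.ρ _⁻¹)] at hc1
  rw [hsum, ← h, ← hc1]
  ring

theorem apply_one_ne_zero [Fintype G] (hf : IsIrreducibleCharacter G f) : f 1 ≠ 0 := by
  intro h0
  have hG : (Nat.card G : ℂ) ≠ 0 := Nat.cast_ne_zero.2 Nat.card_pos.ne'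
  refine hG ?_
  have hz : ∀ k, f k = 0 := fun k => by
    have h := hf.apply_one_mul_sum k
    rw [h0, zero_mul] at h
    exact (mul_eq_zero.1 h.symm).resolve_left hG
  rw [← hf.sum_mul_inv_self]
  simp [hz]

end IsIrreducibleCharacter

open scoped MonoidAlgebra in
theorem Representation.isIrreducible_of_asAlgebraHom_eq_lsmul {k G S : Type*} [Field k] [Monoid G]
    [AddCommGroup S] [Module k S] [Module k[G] S] [IsScalarTower k k[G] S] [IsSimpleModule k[G] S]
    (ρ : Representation k G S) (hρ : ρ.asAlgebraHom = Algebra.lsmul k k S) : ρ.IsIrreducible := by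
  rw [Representation.irreducible_iff_isSimpleModule_asModule]
  let e : ρ.asModule ≃ₗ[k[G]] S :=
    { ρ.asModuleEquiv.toAddEquiv with
      map_smul' := fun r x => by
        change ρ.asModuleEquiv (r • x) = r • ρ.asModuleEquiv x
        rw [Representation.asModuleEquiv_map_smul, hρ]
        rfl }
  exact IsSimpleModule.congr e

open scoped MonoidAlgebra in
theorem eq_zero_of_sum_mul_character_eq_zero {G : Type} [Group G] [Fintype G]
    (h : G → ℂ) (hh : ∀ x g, h (x * g * x⁻¹) = h g)
    (hirr : ∀ f, IsIrreducibleCharacter G f → ∑ g, h g * f g = 0) : h = 0 := by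
  let a : ℂ[G] := ∑ g, MonoidAlgebra.single g (h g)
  have hcomm : ∀ x, x * a = a * x := fun x => by
    induction x using MonoidAlgebra.induction_linear with
    | zero => simp
    | add x y hx hy => rw [add_mul, mul_add, hx, hy]
    | single x r =>
      simp only [a, Finset.sum_mul, Finset.mul_sum, MonoidAlgebra.single_mul_single]
      refine Fintype.sum_equiv (MulAut.conj x).toEquiv _ _ fun g => ?_
      simp [hh, mul_comm]
  have htop : (⊤ : Submodule ℂ[G] ℂ[G]) ≤
      LinearMap.ker (LinearMap.toSpanSingleton ℂ[G] ℂ[G] a) := by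
    rw [← IsSemisimpleModule.sSup_simples_eq_top]
    refine sSup_le fun S hS x hx => ?_
    have : IsSimpleModule ℂ[G] S := hS
    have : Module.Finite ℂ S := Module.Finite.trans ℂ[G] S
    let ρ : Representation ℂ G S := (MonoidAlgebra.lift ℂ _ G).symm (Algebra.lsmul ℂ ℂ S)
    have hρ : ρ.asAlgebraHom = Algebra.lsmul ℂ ℂ S :=
      (MonoidAlgebra.lift ℂ _ G).apply_symm_apply _
    have : ρ.IsIrreducible := Representation.isIrreducible_of_asAlgebraHom_eq_lsmul ρ hρ
    have hchar := isIrreducibleCharacter_of_isIrreducible ρ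
    obtain ⟨c, hc, hc1⟩ := Representation.sum_smul_eq_smul_one _ hchar.sum_mul_inv_self h hh
    rw [hirr _ hchar] at hc1
    rw [(mul_eq_zero.1 hc1).resolve_right hchar.apply_one_ne_zero, zero_smul] at hc
    have ha : ρ.asAlgebraHom a = 0 := by
      rw [← hc]
      simp [a, Representation.asAlgebraHom_single]
    rw [hρ] at ha
    have hax : a * x = 0 := congrArg Subtype.val (LinearMap.congr_fun ha ⟨x, hx⟩)
    simpa [hcomm] using hax
  have ha : a = 0 := by simpa using htop (Submodule.mem_top (x := 1))
  funext g
  classical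
  have := congrArg (fun x : ℂ[G] => x.coeff g) ha
  simpa [a, Finsupp.single_apply] using this

theorem card_mul_sum_irreducible_characters {G : Type} [Group G] [Fintype G] [DecidableEq G]
    (Irr : Finset (G → ℂ)) (hIrr : ∀ f, f ∈ Irr ↔ IsIrreducibleCharacter G f)
    (m : G) (M : Finset G) (hM : ∀ x, x ∈ M ↔ IsConj m x) (k : G) :
    (M.card : ℂ) * ∑ f ∈ Irr, f m * f k⁻¹ = Nat.card G * if k ∈ M then 1 else 0 := by
  have hMconj : ∀ x g, x * g * x⁻¹ ∈ M ↔ g ∈ M := fun x g => by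
    have hxg : IsConj g (x * g * x⁻¹) := isConj_iff.2 ⟨x, rfl⟩
    rw [hM, hM]
    exact ⟨fun h => h.trans hxg.symm, fun h => h.trans hxg⟩
  have key := eq_zero_of_sum_mul_character_eq_zero
    (fun k => (M.card : ℂ) * ∑ f ∈ Irr, f m * f k⁻¹ - Nat.card G * if k ∈ M then 1 else 0)
    (fun x g => by
      simp only [hMconj]
      congr 2
      refine Finset.sum_congr rfl fun f hf => ?_
      rw [← ((hIrr f).1 hf).map_conj x g⁻¹]
      simp only [mul_inv_rev, inv_inv, mul_assoc])
    fun f hf => by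
      have hsum : ∑ k, (∑ f' ∈ Irr, f' m * f' k⁻¹) * f k = f m * Nat.card G := by
        simp only [Finset.sum_mul]
        rw [Finset.sum_comm, Finset.sum_eq_single_of_mem f ((hIrr f).2 hf)]
        · rw [← hf.sum_mul_inv_self, Finset.mul_sum]
          exact Finset.sum_congr rfl fun k _ => by ring
        · intro f' hf' hne
          have h0 := hf.sum_mul_inv_of_ne ((hIrr f').1 hf') hne.symm
          rw [← mul_zero (f' m), ← h0, Finset.mul_sum]
          exact Finset.sum_congr rfl fun k _ => by ring
      have hM' : ∑ k, (if k ∈ M then (1 : ℂ) else 0) * f k = M.card * f m := by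
        simp only [ite_mul, one_mul, zero_mul, Finset.sum_ite_mem, Finset.univ_inter]
        rw [← nsmul_eq_mul, ← Finset.sum_const]
        refine Finset.sum_congr rfl fun k hk => ?_
        obtain ⟨x, rfl⟩ := isConj_iff.1 ((hM k).1 hk)
        exact hf.map_conj x m
      simp only [sub_mul, Finset.sum_sub_distrib, mul_assoc]
      rw [← Finset.mul_sum, ← Finset.mul_sum, hsum, hM']
      ring
  exact sub_eq_zero.1 (congrFun key k)

section Frobenius

variable {V : Type*} [NormedAddCommGroup V] [InnerProductSpace ℂ V]

theorem conjEnd_outerSelf {G : Type*} [Group G] (ρ : G →* (V ≃ₗᵢ[ℂ] V)) (g : G) (b : V) :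
    conjEnd ρ g (outerSelf b) = outerSelf (ρ g b) := by
  ext v
  have : ⟪b, (ρ g).symm v⟫_ℂ = ⟪ρ g b, v⟫_ℂ := by
    rw [← (ρ g).inner_map_map, LinearIsometryEquiv.apply_symm_apply]
  simp [conjEnd, outerSelf, this]

variable [FiniteDimensional ℂ V]

theorem adjoint_outerSelf (u : V) : LinearMap.adjoint (outerSelf u) = outerSelf u := by
  symm
  rw [LinearMap.eq_adjoint_iff]
  intro x y
  simp [outerSelf, inner_smul_left, inner_smul_right, mul_comm]

theorem frobInner_outerSelf (u v : V) :
    frobInner (outerSelf u) (outerSelf v) = ((‖⟪u, v⟫_ℂ‖ ^ 2 : ℝ) : ℂ) := by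
  have : outerSelf u ∘ₗ outerSelf v = (innerₛₗ ℂ v).smulRight (⟪u, v⟫_ℂ • u) := by
    ext x
    simp [outerSelf, inner_smul_right, smul_smul]
  rw [frobInner, adjoint_outerSelf, this, LinearMap.trace_smulRight]
  rw [innerₛₗ_apply_apply, inner_smul_right, ← inner_conj_symm v u, Complex.mul_conj']
  push_cast
  rfl

theorem frobInner_sum_smul {ι : Type*} (s : Finset ι) (c : ι → ℂ) (A : ι → V →ₗ[ℂ] V) :
    frobInner (∑ i ∈ s, c i • A i) (∑ j ∈ s, c j • A j) =
      ∑ i ∈ s, ∑ j ∈ s, starRingEnd ℂ (c i) * c j * frobInner (A i) (A j) := by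
  simp only [frobInner, ← Module.End.mul_eq_comp, map_sum, map_smulₛₗ, Finset.sum_mul_sum,
    smul_mul_smul_comm, smul_eq_mul]
  simp

theorem frobInner_smul_smul (c : ℂ) (A B : V →ₗ[ℂ] V) :
    frobInner (c • A) (c • B) = starRingEnd ℂ c * c * frobInner A B := by
  simp only [frobInner, ← Module.End.mul_eq_comp, map_smulₛₗ, smul_mul_smul_comm, smul_eq_mul]
  simp

theorem frobInner_isotypicProjEnd_outerSelf {G : Type} [Group G] [Fintype G]
    (ρ : G →* (V ≃ₗᵢ[ℂ] V)) {f : G → ℂ} (hf : IsIrreducibleCharacter G f) (b : V) :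
    frobInner (isotypicProjEnd ρ f (outerSelf b)) (isotypicProjEnd ρ f (outerSelf b)) =
      f 1 / Nat.card G * ∑ k, f k⁻¹ * ((‖⟪b, ρ k b⟫_ℂ‖ ^ 2 : ℝ) : ℂ) := by
  have hG : (Nat.card G : ℂ) ≠ 0 := Nat.cast_ne_zero.2 Nat.card_pos.ne'
  have hinner : ∀ g k, ⟪ρ g b, ρ (g * k) b⟫_ℂ = ⟪b, ρ k b⟫_ℂ := fun g k => by
    rw [map_mul]
    exact (ρ g).inner_map_map b (ρ k b)
  have hsum : ∑ g, ∑ k, f g * f k⁻¹ * ((‖⟪ρ g b, ρ k b⟫_ℂ‖ ^ 2 : ℝ) : ℂ) =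
      ∑ k, (∑ g, f g * f (k⁻¹ * g⁻¹)) * ((‖⟪b, ρ k b⟫_ℂ‖ ^ 2 : ℝ) : ℂ) := by
    simp only [Finset.sum_mul]
    refine Eq.trans (Finset.sum_congr rfl fun g _ => ?_) Finset.sum_comm
    rw [← Equiv.sum_comp (Equiv.mulLeft g)]
    simp only [Equiv.coe_mulLeft, hinner, mul_inv_rev]
  simp only [isotypicProjEnd, frobInner_smul_smul, frobInner_sum_smul, conjEnd_outerSelf,
    frobInner_outerSelf, hf.conj_apply, inv_inv, map_div₀, Complex.conj_natCast, inv_one]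
  rw [hsum, Finset.mul_sum, Finset.mul_sum]
  refine Finset.sum_congr rfl fun k _ => ?_
  have hk := hf.apply_one_mul_sum k⁻¹
  calc f 1 / Nat.card G * (f 1 / Nat.card G) *
        ((∑ g, f g * f (k⁻¹ * g⁻¹)) * ((‖⟪b, ρ k b⟫_ℂ‖ ^ 2 : ℝ) : ℂ))
      = f 1 / Nat.card G / Nat.card G * (f 1 * ∑ g, f g * f (k⁻¹ * g⁻¹)) *
          ((‖⟪b, ρ k b⟫_ℂ‖ ^ 2 : ℝ) : ℂ) := by ring
    _ = _ := by rw [hk]; field_simp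

end Frobenius

/-- For a unitary representation `ρ` of a finite group `G` on `V` and a
conjugacy class `M = [m₀]` of involutions, the expectation of `|⟨b, ρ(m)b⟩|²` over uniform
`m ∈ M` equals `Σ_σ (χ_σ([m])/d_σ)·‖Π_σ(|b⟩⟨b|)‖²`, where `Π_σ` is the orthogonal
projection of `End(V)` (with Frobenius inner product) onto the `σ`-isotypic component of
the conjugation representation. -/
theorem expectation_inner_sq_conjClass_involutions
    {G : Type} {V : Type*} [Group G] [Fintype G] [NormedAddCommGroup V]
    [InnerProductSpace ℂ V] [FiniteDimensional ℂ V] (ρ : G →* (V ≃ₗᵢ[ℂ] V))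
    (Irr : Finset (G → ℂ)) (hIrr : ∀ f, f ∈ Irr ↔ IsIrreducibleCharacter G f)
    (m₀ : G) (hm₀ : m₀ * m₀ = 1)
    (M : Finset G) (hM : ∀ m, m ∈ M ↔ IsConj m₀ m)
    (b : V) :
    (M.card : ℂ)⁻¹ * ∑ m ∈ M, ((‖⟪b, ρ m b⟫_ℂ‖ ^ 2 : ℝ) : ℂ)
      = ∑ f ∈ Irr, (f m₀ / f 1) *
          frobInner (isotypicProjEnd ρ f (outerSelf b)) (isotypicProjEnd ρ f (outerSelf b)) := by
  classical
  have hG : (Nat.card G : ℂ) ≠ 0 := Nat.cast_ne_zero.2 Nat.card_pos.ne'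
  have hMcard : (M.card : ℂ) ≠ 0 :=
    Nat.cast_ne_zero.2 (Finset.card_ne_zero_of_mem ((hM m₀).2 (IsConj.refl m₀)))
  have hcol : ∀ k, ∑ f ∈ Irr, f m₀ * f k⁻¹ =
      (M.card : ℂ)⁻¹ * (Nat.card G * if k ∈ M then 1 else 0) := fun k => by
    rw [← card_mul_sum_irreducible_characters Irr hIrr m₀ M hM k, inv_mul_cancel_left₀ hMcard]
  symm
  calc _ = ∑ f ∈ Irr, ∑ k, (Nat.card G : ℂ)⁻¹ * (f m₀ * f k⁻¹) *
          ((‖⟪b, ρ k b⟫_ℂ‖ ^ 2 : ℝ) : ℂ) := by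
        refine Finset.sum_congr rfl fun f hf => ?_
        have hf' := (hIrr f).1 hf
        have h1 := hf'.apply_one_ne_zero
        rw [frobInner_isotypicProjEnd_outerSelf ρ hf' b, Finset.mul_sum, Finset.mul_sum]
        refine Finset.sum_congr rfl fun k _ => ?_
        field_simp
    _ = ∑ k, (M.card : ℂ)⁻¹ * ((if k ∈ M then 1 else 0) *
          ((‖⟪b, ρ k b⟫_ℂ‖ ^ 2 : ℝ) : ℂ)) := by
        rw [Finset.sum_comm]
        refine Finset.sum_congr rfl fun k _ => ?_
        rw [← Finset.sum_mul, ← Finset.mul_sum, hcol]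
        field_simp
    _ = _ := by
        rw [← Finset.mul_sum]
        simp only [ite_mul, one_mul, zero_mul, Finset.sum_ite_mem, Finset.univ_inter]
end

section
/- Let V be a finite-dimensional complex inner product space, and let {b_j} be a finite family of unit vectors in V with positive real weights {a_j} satisfying the completeness condition Σ_j a_j |b_j⟩⟨b_j| = id_V. Equip End(V) with the Frobenius inner product ⟨A,B⟩ = tr(A†B). Then for every linear subspace L ⊆ End(V) with orthogonal projection Π_L onto L, one has Σ_j a_j ‖Π_L(|b_j⟩⟨b_j|)‖² ≤ dim L. -/
open scoped InnerProductSpace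

section Frobenius

variable {V : Type*} [NormedAddCommGroup V] [InnerProductSpace ℂ V] [FiniteDimensional ℂ V]

lemma frobInner_eq_sum_inner {ι : Type*} [Fintype ι] (e : OrthonormalBasis ι ℂ V)
    (A B : V →ₗ[ℂ] V) : frobInner A B = ∑ i, ⟪A (e i), B (e i)⟫_ℂ := by
  simp [frobInner, LinearMap.trace_eq_sum_inner _ e, LinearMap.adjoint_inner_right]

variable (V) in
/-- The Frobenius inner product makes `End(V)` an inner product space. -/
noncomputable abbrev frobInnerCore : InnerProductSpace.Core ℂ (V →ₗ[ℂ] V) where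
  inner := frobInner
  conj_inner_symm A B := by
    simp [frobInner_eq_sum_inner (stdOrthonormalBasis ℂ V)]
  re_inner_nonneg A := by
    rw [frobInner_eq_sum_inner (stdOrthonormalBasis ℂ V), map_sum]
    exact Finset.sum_nonneg fun _ _ => inner_self_nonneg
  add_left A B C := by simp [frobInner, LinearMap.add_comp]
  smul_left A B r := by simp [frobInner, map_smulₛₗ, LinearMap.smul_comp]
  definite A h := by
    rw [frobInner_eq_sum_inner (stdOrthonormalBasis ℂ V)] at h
    have h' := congrArg (RCLike.re (K := ℂ)) h
    rw [map_sum, map_zero, Finset.sum_eq_zero_iff_of_nonneg fun _ _ => inner_self_nonneg (𝕜 := ℂ)] at h'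
    refine (stdOrthonormalBasis ℂ V).toBasis.ext fun i => ?_
    have := h' i (Finset.mem_univ i)
    simpa [← Complex.ofReal_pow, inner_self_eq_norm_sq_to_K] using this

lemma exists_frobInner_orthonormal_basis (L : Submodule ℂ (V →ₗ[ℂ] V)) :
    ∃ E : Fin (Module.finrank ℂ L) → (V →ₗ[ℂ] V),
      (∀ k, E k ∈ L) ∧ (∀ k, frobInner (E k) (E k) = 1) ∧
      ∀ A ∈ L, (frobInner A A).re = ∑ k, ‖frobInner (E k) A‖ ^ 2 := by
  let : NormedAddCommGroup (V →ₗ[ℂ] V) := (frobInnerCore V).toNormedAddCommGroup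
  let : InnerProductSpace ℂ (V →ₗ[ℂ] V) := InnerProductSpace.ofCore (frobInnerCore V).toCore
  let e := stdOrthonormalBasis ℂ L
  refine ⟨fun k => e k, fun k => (e k).2, fun k => ?_, fun A hA => ?_⟩
  · exact (inner_self_eq_one_of_norm_eq_one (𝕜 := ℂ) (e.norm_eq_one k) :)
  · have h := e.sum_sq_norm_inner_right ⟨A, hA⟩
    rw [← inner_self_eq_norm_sq (𝕜 := ℂ)] at h
    exact h.symm

lemma frobInner_outerSelf_s8 (A : V →ₗ[ℂ] V) (b : V) :
    frobInner A (outerSelf b) = ⟪A b, b⟫_ℂ := by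
  have h : LinearMap.adjoint A ∘ₗ outerSelf b
      = (innerₛₗ ℂ b).smulRight (LinearMap.adjoint A b) := by
    ext v
    simp [outerSelf]
  rw [frobInner, h, LinearMap.trace_smulRight]
  simp [LinearMap.adjoint_inner_right]

lemma sum_mul_norm_sq_apply_of_frame {ι : Type*} [Fintype ι] {b : ι → V} {a : ι → ℝ}
    (hcomplete : ∑ j, (a j : ℂ) • outerSelf (b j) = LinearMap.id) (A : V →ₗ[ℂ] V) :
    ∑ j, a j * ‖A (b j)‖ ^ 2 = (frobInner A A).re := by
  have h : frobInner A A = frobInner (LinearMap.adjoint A ∘ₗ A) LinearMap.id := by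
    simp [frobInner, LinearMap.adjoint_comp]
  have hlin : frobInner (LinearMap.adjoint A ∘ₗ A) (∑ j, (a j : ℂ) • outerSelf (b j))
      = ∑ j, (a j : ℂ) * frobInner (LinearMap.adjoint A ∘ₗ A) (outerSelf (b j)) := by
    simp only [frobInner, ← Module.End.mul_eq_comp, Finset.mul_sum, mul_smul_comm, map_sum, map_smul, smul_eq_mul]
  rw [h, ← hcomplete, hlin, Complex.re_sum]
  refine Finset.sum_congr rfl fun j _ => ?_
  rw [frobInner_outerSelf_s8, LinearMap.comp_apply, LinearMap.adjoint_inner_left,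
    inner_self_eq_norm_sq_to_K, Complex.re_ofReal_mul]
  norm_cast

end Frobenius

/-- Let `{b_j}` be a finite family of unit vectors of `V` with positive
weights `{a_j}` satisfying the completeness condition `Σ_j a_j |b_j⟩⟨b_j| = id`.  For any
subspace `L ⊆ End(V)` with orthogonal projection `P = Π_L` onto `L` (with respect to the
Frobenius inner product), one has `Σ_j a_j ‖Π_L(|b_j⟩⟨b_j|)‖² ≤ dim L`. -/
theorem frame_isotypic_projection_sum_le_dim
    {V : Type*} [NormedAddCommGroup V] [InnerProductSpace ℂ V] [FiniteDimensional ℂ V]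
    {ι : Type*} [Fintype ι] (b : ι → V) (hb : ∀ j, ‖b j‖ = 1)
    (a : ι → ℝ) (ha : ∀ j, 0 < a j)
    (hcomplete : ∑ j, (a j : ℂ) • outerSelf (b j) = LinearMap.id)
    (L : Submodule ℂ (V →ₗ[ℂ] V))
    (P : (V →ₗ[ℂ] V) →ₗ[ℂ] (V →ₗ[ℂ] V))
    (hPmem : ∀ A, P A ∈ L)
    (hPid : ∀ A ∈ L, P A = A)
    (hPorth : ∀ A : V →ₗ[ℂ] V, ∀ B ∈ L, frobInner B (A - P A) = 0) :
    ∑ j, a j * (frobInner (P (outerSelf (b j))) (P (outerSelf (b j)))).re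
      ≤ (Module.finrank ℂ L : ℝ) := by
  obtain ⟨E, hEL, hE, hParseval⟩ := exists_frobInner_orthonormal_basis L
  have hproj : ∀ k A, frobInner (E k) (P A) = frobInner (E k) A := fun k A => by
    have h := hPorth A (E k) (hEL k)
    simp only [frobInner, LinearMap.comp_sub, map_sub] at h
    exact (sub_eq_zero.mp h).symm
  have hcs : ∀ k j, ‖frobInner (E k) (outerSelf (b j))‖ ≤ ‖E k (b j)‖ := fun k j => by
    rw [frobInner_outerSelf_s8]
    simpa [hb j] using norm_inner_le_norm (𝕜 := ℂ) (E k (b j)) (b j)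
  calc ∑ j, a j * (frobInner (P (outerSelf (b j))) (P (outerSelf (b j)))).re
      = ∑ j, a j * ∑ k, ‖frobInner (E k) (outerSelf (b j))‖ ^ 2 := by
        simp only [hParseval _ (hPmem _), hproj]
    _ ≤ ∑ j, a j * ∑ k, ‖E k (b j)‖ ^ 2 := by
        gcongr with j _ k _
        · exact (ha j).le
        · exact hcs k j
    _ = ∑ k, ∑ j, a j * ‖E k (b j)‖ ^ 2 := by
        simp only [Finset.mul_sum]
        exact Finset.sum_comm
    _ = Module.finrank ℂ L := by
        simp [sum_mul_norm_sq_apply_of_frame hcomplete, hE]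
end

section
/- Let 0 < c < 1/2. There exists γ > 0 such that for all sufficiently large n, the probability that an irreducible complex representation λ of the symmetric group S_n, chosen according to the Plancherel distribution, has dimension d_λ ≤ n^{cn} is at most n^{−γn}. Equivalently, Σ_{λ : d_λ ≤ n^{cn}} d_λ²/n! ≤ n^{−γn}, the sum running over isomorphism classes of irreducible complex representations of S_n. -/
open scoped Classical

/-- The characters of pairwise non-isomorphic irreducible representations of a finite group are
linearly independent. -/
theorem FDRep.linearIndependent_character {G : Type} [Group G] [Fintype G] {ι : Type*}
    (R : ι → FDRep ℂ G) (hR : ∀ i, CategoryTheory.Simple (R i))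
    (hne : ∀ i j, i ≠ j → ¬ Nonempty (R i ≅ R j)) :
    LinearIndependent ℂ fun i => (R i).character := by
  have : Invertible (Nat.card G : ℂ) := invertibleOfNonzero (by simp)
  rw [linearIndependent_iff']
  intro s a ha j hj
  have key : ∑ i ∈ s, a i *
      ((Nat.card G : ℂ)⁻¹ * ∑ g : G, (R i).character g * (R j).character g⁻¹) = 0 := by
    have hzero : ∀ g, ∑ i ∈ s, a i * (R i).character g = 0 := fun g => by
      simpa using congrFun ha g
    calc _ = (Nat.card G : ℂ)⁻¹ *
          ∑ g : G, (∑ i ∈ s, a i * (R i).character g) * (R j).character g⁻¹ := by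
          simp_rw [Finset.sum_mul, Finset.mul_sum]
          rw [Finset.sum_comm]
          exact Finset.sum_congr rfl fun _ _ => Finset.sum_congr rfl fun _ _ => by ring
      _ = 0 := by simp [hzero]
  have horth : ∀ i, (Nat.card G : ℂ)⁻¹ * ∑ g : G, (R i).character g * (R j).character g⁻¹ =
      if i = j then 1 else 0 := fun i => by
    have := hR i
    have := hR j
    rw [FDRep.char_orthonormal]
    by_cases h : i = j
    · subst h
      simp [show Nonempty (R i ≅ R i) from ⟨CategoryTheory.Iso.refl _⟩]
    · simp [h, hne i j h]
  simp_rw [horth] at key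
  simpa [hj] using key

/-- A finite group has at most as many pairwise non-isomorphic irreducible complex
representations as conjugacy classes. -/
theorem FDRep.card_le_card_conjClasses {G : Type} [Group G] [Fintype G] {ι : Type*} [Fintype ι]
    (R : ι → FDRep ℂ G) (hR : ∀ i, CategoryTheory.Simple (R i))
    (hne : ∀ i j, i ≠ j → ¬ Nonempty (R i ≅ R j)) :
    Fintype.card ι ≤ Fintype.card (ConjClasses G) := by
  let χ : ι → ConjClasses G → ℂ := fun i =>
    Quotient.lift (R i).character fun g h hgh => by
      obtain ⟨x, rfl⟩ := isConj_iff.mp (show IsConj g h from hgh)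
      rw [FDRep.char_conj]
  have hχ : LinearIndependent ℂ χ :=
    LinearIndependent.of_comp (LinearMap.funLeft ℂ ℂ (ConjClasses.mk : G → ConjClasses G))
      (FDRep.linearIndependent_character R hR hne)
  simpa using hχ.fintype_card_le_finrank

theorem Nat.Partition.card_le_two_pow (n : ℕ) : Fintype.card n.Partition ≤ 2 ^ n :=
  calc Fintype.card n.Partition ≤ Fintype.card (Composition n) :=
        Fintype.card_le_of_surjective _ Nat.Partition.ofComposition_surj
    _ = 2 ^ (n - 1) := composition_card n
    _ ≤ 2 ^ n := Nat.pow_le_pow_right two_pos (Nat.sub_le n 1)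

theorem Equiv.Perm.card_conjClasses_le_card_partition (α : Type*) [Fintype α] [DecidableEq α] :
    Fintype.card (ConjClasses (Equiv.Perm α)) ≤ Fintype.card (Fintype.card α).Partition := by
  let f : ConjClasses (Equiv.Perm α) → (Fintype.card α).Partition :=
    Quotient.lift Equiv.Perm.partition fun _ _ h => Equiv.Perm.partition_eq_of_isConj.mp h
  refine Fintype.card_le_of_injective f fun a b => ?_
  induction a, b using Quotient.inductionOn₂ with
  | h σ τ => exact fun h => Quotient.sound (Equiv.Perm.partition_eq_of_isConj.mpr h)

/-- Let `0 < c < 1/2`.  There exists `γ > 0` such that for all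
sufficiently large `n`, the Plancherel probability that an irreducible complex
representation `λ` of `S_n` has dimension `d_λ ≤ n^{cn}` is at most `n^{−γn}`; that is,
`Σ_{λ : d_λ ≤ n^{cn}} d_λ²/n! ≤ n^{−γn}`, the sum running over a complete family of
pairwise non-isomorphic irreducible complex representations of `S_n`. -/
theorem plancherel_dimension_le_npow_unlikely
    (c : ℝ) (hc0 : 0 < c) (hc : c < 1 / 2) :
    ∃ γ > (0 : ℝ), ∃ N : ℕ, ∀ n ≥ N,
      ∀ (ι : Type) [Fintype ι] (R : ι → FDRep ℂ (Equiv.Perm (Fin n))),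
        (∀ i, CategoryTheory.Simple (R i)) →
        (∀ i j, i ≠ j → ¬ Nonempty (R i ≅ R j)) →
        (∀ W : FDRep ℂ (Equiv.Perm (Fin n)), CategoryTheory.Simple W →
          ∃ i, Nonempty (W ≅ R i)) →
        ∑ i ∈ Finset.univ.filter (fun i =>
              (Module.finrank ℂ (R i) : ℝ) ≤ (n : ℝ) ^ (c * (n : ℝ))),
            (Module.finrank ℂ (R i) : ℝ) ^ 2 / (n.factorial : ℝ)
          ≤ (n : ℝ) ^ (-(γ * (n : ℝ))) := by
  have hγ : 0 < (1 - 2 * c) / 2 := by linarith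
  obtain ⟨N, hN⟩ := Filter.eventually_atTop.mp
    (((tendsto_rpow_atTop hγ).comp tendsto_natCast_atTop_atTop).eventually_ge_atTop
      (2 * Real.exp 1))
  refine ⟨(1 - 2 * c) / 2, hγ, max N 1, fun n hn ι _ R hR hne _ => ?_⟩
  have hbase : 2 * Real.exp 1 ≤ (n : ℝ) ^ ((1 - 2 * c) / 2) := hN n (le_of_max_le_left hn)
  have hn0 : (0 : ℝ) < n := by exact_mod_cast (le_of_max_le_right hn : 1 ≤ n)
  have hcard : (Fintype.card ι : ℝ) ≤ 2 ^ n := by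
    have h := (Equiv.Perm.card_conjClasses_le_card_partition (Fin n)).trans
      (Nat.Partition.card_le_two_pow _)
    simp only [Fintype.card_fin] at h
    exact_mod_cast (FDRep.card_le_card_conjClasses R hR hne).trans (by convert! h)
  have hfact : (1 : ℝ) / n.factorial ≤ Real.exp 1 ^ n / (n : ℝ) ^ n := by
    have h := Real.pow_div_factorial_le_exp (n : ℝ) hn0.le n
    rw [← Real.exp_one_pow] at h
    rw [le_div_iff₀ (by positivity)]
    calc _ = (n : ℝ) ^ n / n.factorial := by ring
      _ ≤ _ := h
  calc _ ≤ ∑ i ∈ Finset.univ.filter (fun i =>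
              (Module.finrank ℂ (R i) : ℝ) ≤ (n : ℝ) ^ (c * (n : ℝ))),
            ((n : ℝ) ^ (c * (n : ℝ))) ^ 2 / (n.factorial : ℝ) := by
        refine Finset.sum_le_sum fun i hi => ?_
        have := (Finset.mem_filter.mp hi).2
        gcongr
    _ ≤ (Fintype.card ι : ℝ) * (((n : ℝ) ^ (c * (n : ℝ))) ^ 2 / (n.factorial : ℝ)) := by
        rw [Finset.sum_const, nsmul_eq_mul]
        gcongr
        exact Finset.card_le_univ _
    _ = (Fintype.card ι : ℝ) * ((n : ℝ) ^ (c * (n : ℝ))) ^ 2 * (1 / n.factorial) := by ring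
    _ ≤ 2 ^ n * ((n : ℝ) ^ (c * (n : ℝ))) ^ 2 * (Real.exp 1 ^ n / (n : ℝ) ^ n) := by gcongr
    _ = (2 * Real.exp 1) ^ n * (((n : ℝ) ^ (c * (n : ℝ))) ^ 2 / (n : ℝ) ^ n) := by
        rw [mul_pow]; ring
    _ ≤ ((n : ℝ) ^ ((1 - 2 * c) / 2)) ^ n * (((n : ℝ) ^ (c * (n : ℝ))) ^ 2 / (n : ℝ) ^ n) := by
        gcongr
    _ = (n : ℝ) ^ (-((1 - 2 * c) / 2 * (n : ℝ))) := by
        rw [← Real.rpow_mul_natCast hn0.le, ← Real.rpow_mul_natCast hn0.le,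
          ← Real.rpow_natCast (n : ℝ) n, ← Real.rpow_sub hn0, ← Real.rpow_add hn0]
        congr 1
        push_cast
        ring
end

section
/- Let 0 < d < 1/2 and let H be a subgroup of the symmetric group S_n with |H| = 2. For each irreducible unitary representation ρ of S_n with dimension d_ρ, let Π_H^ρ = (1/2) Σ_{h∈H} ρ(h) and define P(ρ) = (2 d_ρ/n!)·rk Π_H^ρ (the probability of observing ρ when weak Fourier sampling the coset state of H). Then for every γ < 1 − 2d and all sufficiently large n, Σ_{ρ : d_ρ < n^{dn}} P(ρ) < n^{−γn}; that is, with probability at least 1 − n^{−γn} one observes a representation of dimension at least n^{dn}. -/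
open scoped Classical

open Module in
/-- The characters of pairwise non-isomorphic irreducible representations of a finite group are
linearly independent. -/
theorem Representation.linearIndependent_character {G k ι : Type*} [Group G] [Fintype G] [Field k]
    [IsAlgClosed k] [Invertible (Nat.card G : k)] [Fintype ι] {V : ι → Type*}
    [∀ i, AddCommGroup (V i)] [∀ i, Module k (V i)] [∀ i, FiniteDimensional k (V i)]
    (ρ : ∀ i, Representation k G (V i)) [∀ i, (ρ i).IsIrreducible]
    (hρ : ∀ i j, i ≠ j → IsEmpty ((ρ i).Equiv (ρ j))) :
    LinearIndependent k fun i => (ρ i).character := by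
  rw [Fintype.linearIndependent_iff]
  intro c hc j
  have orth (i : ι) : (Nat.card G : k)⁻¹ * ∑ g : G, (ρ i).character g * (ρ j).character g⁻¹ =
      if i = j then 1 else 0 := by
    rw [Representation.char_orthonormal]
    rcases eq_or_ne i j with rfl | hij
    · simp [show Nonempty ((ρ i).Equiv (ρ i)) from ⟨Representation.Equiv.refl _⟩]
    · simp [hij, hρ j i hij.symm]
  have key : ∑ i, c i * ((Nat.card G : k)⁻¹ *
      ∑ g : G, (ρ i).character g * (ρ j).character g⁻¹) = 0 := by
    simp_rw [Finset.mul_sum]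
    rw [Finset.sum_comm]
    refine Finset.sum_eq_zero fun g _ => ?_
    have hg : ∑ i, c i * (ρ i).character g = 0 := by simpa using congrFun hc g
    calc ∑ i, c i * ((Nat.card G : k)⁻¹ * ((ρ i).character g * (ρ j).character g⁻¹))
        = (∑ i, c i * (ρ i).character g) * ((Nat.card G : k)⁻¹ * (ρ j).character g⁻¹) := by
          rw [Finset.sum_mul]
          exact Finset.sum_congr rfl fun i _ => by ring
      _ = 0 := by rw [hg, zero_mul]
  simp_rw [orth] at key
  simpa using key

/-- A finite group has at most as many pairwise non-isomorphic irreducible representations as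
conjugacy classes. -/
theorem Representation.card_le_card_conjClasses {G k ι : Type*} [Group G] [Fintype G] [Field k]
    [IsAlgClosed k] [Invertible (Nat.card G : k)] [Fintype ι] {V : ι → Type*}
    [∀ i, AddCommGroup (V i)] [∀ i, Module k (V i)] [∀ i, FiniteDimensional k (V i)]
    (ρ : ∀ i, Representation k G (V i)) [∀ i, (ρ i).IsIrreducible]
    (hρ : ∀ i j, i ≠ j → IsEmpty ((ρ i).Equiv (ρ j))) :
    Fintype.card ι ≤ Nat.card (ConjClasses G) := by
  let χ (i : ι) : ConjClasses G → k := Quotient.lift (ρ i).character fun a b hab => by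
    obtain ⟨c, rfl⟩ := isConj_iff.mp hab
    exact ((ρ i).char_conj a c).symm
  have hχ : LinearIndependent k χ :=
    .of_comp (LinearMap.funLeft k k ConjClasses.mk) (linearIndependent_character ρ hρ)
  simpa [Nat.card_eq_fintype_card] using hχ.fintype_card_le_finrank

theorem Equiv.Perm.card_conjClasses_le (n : ℕ) :
    Nat.card (ConjClasses (Equiv.Perm (Fin n))) ≤ 2 ^ n := by
  let f : ConjClasses (Equiv.Perm (Fin n)) → (Fintype.card (Fin n)).Partition :=
    Quotient.lift Equiv.Perm.partition fun _ _ h => Equiv.Perm.partition_eq_of_isConj.mp h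
  have hf : Function.Injective f := by
    rintro ⟨a⟩ ⟨b⟩ h
    exact Quotient.sound (Equiv.Perm.partition_eq_of_isConj.mpr h)
  calc Nat.card (ConjClasses (Equiv.Perm (Fin n)))
      ≤ Fintype.card (Fintype.card (Fin n)).Partition := by
        simpa using Nat.card_le_card_of_injective f hf
    _ ≤ Fintype.card (Composition (Fintype.card (Fin n))) :=
        Fintype.card_le_of_surjective _ Nat.Partition.ofComposition_surj
    _ = 2 ^ (n - 1) := by rw [composition_card, Fintype.card_fin]
    _ ≤ 2 ^ n := Nat.pow_le_pow_right two_pos (Nat.sub_le n 1)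

open Filter in
theorem eventually_two_pow_mul_rpow_sq_div_factorial_lt {d γ : ℝ} (hγ : γ < 1 - 2 * d) :
    ∀ᶠ n : ℕ in atTop,
      2 ^ n * (2 * ((n : ℝ) ^ (d * (n : ℝ))) ^ 2 / (n.factorial : ℝ)) <
        (n : ℝ) ^ (-(γ * (n : ℝ))) := by
  have hδ : 0 < 1 - 2 * d - γ := by linarith
  have hlim := (tendsto_rpow_atTop hδ).comp (tendsto_natCast_atTop_atTop (R := ℝ))
  filter_upwards [hlim.eventually_gt_atTop (4 * Real.exp 1), eventually_ge_atTop 1] with n hn hn1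
  have hn0 : (0 : ℝ) < n := by exact_mod_cast hn1
  have hfac : (0 : ℝ) < n.factorial := by positivity
  have hstir : (n : ℝ) ^ (n : ℝ) ≤ Real.exp 1 ^ n * n.factorial := by
    rw [Real.rpow_natCast, ← div_le_iff₀ hfac, ← Real.exp_nat_mul, mul_one]
    exact Real.pow_div_factorial_le_exp _ hn0.le n
  have hpow : 2 ^ n * (2 * Real.exp 1 ^ n) < (n : ℝ) ^ ((1 - 2 * d - γ) * n) := by
    calc 2 ^ n * (2 * Real.exp 1 ^ n) ≤ 2 ^ n * (2 ^ n * Real.exp 1 ^ n) := by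
          gcongr
          exact le_self_pow₀ one_le_two (by omega)
      _ = (4 * Real.exp 1) ^ n := by rw [← mul_pow, ← mul_pow]; ring
      _ < ((n : ℝ) ^ (1 - 2 * d - γ)) ^ n :=
          pow_lt_pow_left₀ hn (by positivity) (by omega)
      _ = (n : ℝ) ^ ((1 - 2 * d - γ) * n) := by rw [Real.rpow_mul hn0.le, Real.rpow_natCast]
  have hsq : ((n : ℝ) ^ (d * (n : ℝ))) ^ 2 = (n : ℝ) ^ (2 * d * n) := by
    rw [← Real.rpow_natCast, ← Real.rpow_mul hn0.le]
    congr 1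
    push_cast
    ring
  rw [hsq, ← mul_div_assoc, div_lt_iff₀ hfac]
  have hpos : 0 < (n : ℝ) ^ (-(γ * (n : ℝ))) := by positivity
  have hpos' : 0 < Real.exp 1 ^ n := by positivity
  refine lt_of_mul_lt_mul_left ?_ hpos'.le
  calc Real.exp 1 ^ n * (2 ^ n * (2 * (n : ℝ) ^ (2 * d * n)))
      = 2 ^ n * (2 * Real.exp 1 ^ n) * (n : ℝ) ^ (2 * d * n) := by ring
    _ < (n : ℝ) ^ ((1 - 2 * d - γ) * n) * (n : ℝ) ^ (2 * d * n) := by gcongr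
    _ = (n : ℝ) ^ (-(γ * (n : ℝ))) * (n : ℝ) ^ (n : ℝ) := by
        rw [← Real.rpow_add hn0, ← Real.rpow_add hn0]
        congr 1
        ring
    _ ≤ (n : ℝ) ^ (-(γ * (n : ℝ))) * (Real.exp 1 ^ n * n.factorial) := by gcongr
    _ = Real.exp 1 ^ n * ((n : ℝ) ^ (-(γ * (n : ℝ))) * n.factorial) := by ring

/-- The representation underlying a unitary representation. -/
def Representation.ofLinearIsometryEquiv {G V : Type*} [Group G] [NormedAddCommGroup V]
    [InnerProductSpace ℂ V] (ρ : G →* (V ≃ₗᵢ[ℂ] V)) : Representation ℂ G V where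
  toFun g := ((ρ g).toLinearEquiv : V →ₗ[ℂ] V)
  map_one' := by ext; simp
  map_mul' g h := by ext; simp

/-- Pairwise non-isomorphic irreducible unitary representations of a finite group number at most
its conjugacy classes; here an irreducible representation may be zero, and the zero ones are not
counted. -/
theorem card_filter_finrank_ne_zero_le_card_conjClasses {G ι : Type*} [Group G] [Fintype G]
    [Fintype ι] (V : ι → Type*) [∀ i, NormedAddCommGroup (V i)]
    [∀ i, InnerProductSpace ℂ (V i)] [∀ i, FiniteDimensional ℂ (V i)]
    (ρ : ∀ i, G →* (V i ≃ₗᵢ[ℂ] V i))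
    (hirr : ∀ i, ∀ W : Submodule ℂ (V i), (∀ g, ∀ v ∈ W, ρ i g v ∈ W) → W = ⊥ ∨ W = ⊤)
    (hniso : ∀ i j, i ≠ j → ∀ f : V i →ₗ[ℂ] V j, (∀ g x, f (ρ i g x) = ρ j g (f x)) → f = 0) :
    (Finset.univ.filter fun i => Module.finrank ℂ (V i) ≠ 0).card ≤
      Nat.card (ConjClasses G) := by
  let σ (i : {i // Module.finrank ℂ (V i) ≠ 0}) := Representation.ofLinearIsometryEquiv (ρ i)
  have : Invertible (Nat.card G : ℂ) := invertibleOfNonzero (Nat.cast_ne_zero.mpr Nat.card_pos.ne')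
  have hnt (i : {i // Module.finrank ℂ (V i) ≠ 0}) : Nontrivial (V i) :=
    Module.nontrivial_of_finrank_pos (Nat.pos_of_ne_zero i.2)
  have hσ (i) : (σ i).IsIrreducible :=
    { exists_pair_ne := ⟨⊥, ⊤, fun h =>
        bot_ne_top (α := Submodule ℂ (V i)) (congrArg Subrepresentation.toSubmodule h)⟩
      eq_bot_or_eq_top := fun W =>
        (hirr i W.toSubmodule fun g v hv => W.apply_mem_toSubmodule g hv).imp
          (fun h => Subrepresentation.toSubmodule_injective h)
          (fun h => Subrepresentation.toSubmodule_injective h) }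
  have hempty (i j) (hij : i ≠ j) : IsEmpty ((σ i).Equiv (σ j)) := by
    refine ⟨fun e => ?_⟩
    have h0 := hniso i j (Subtype.coe_ne_coe.mpr hij) e.toLinearMap
      fun g x => LinearMap.congr_fun (e.isIntertwining' g) x
    obtain ⟨x, hx⟩ := exists_ne (0 : V i)
    exact hx (e.toLinearEquiv.injective
      ((LinearMap.congr_fun h0 x).trans (map_zero e.toLinearEquiv).symm))
  rw [← Fintype.card_subtype]
  exact Representation.card_le_card_conjClasses σ hempty

theorem sum_filter_lt_mul_div_le {ι : Type*} [Fintype ι] (m r : ι → ℕ) (hr : ∀ i, r i ≤ m i)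
    {x F : ℝ} (hF : 0 ≤ F) :
    ∑ i ∈ Finset.univ.filter (fun i => (m i : ℝ) < x), 2 * (m i : ℝ) / F * (r i : ℝ) ≤
      (Finset.univ.filter fun i => m i ≠ 0).card * (2 * x ^ 2 / F) := by
  have hB : 0 ≤ 2 * x ^ 2 / F := by positivity
  rw [← nsmul_eq_mul, ← Finset.sum_const, Finset.sum_filter, Finset.sum_filter]
  refine Finset.sum_le_sum fun i _ => ?_
  by_cases h0 : m i = 0
  · simp [h0]
  rw [if_pos h0]
  split_ifs with hi
  · have hri : (r i : ℝ) ≤ x := le_trans (by exact_mod_cast hr i) hi.le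
    have hx : 0 ≤ x := (Nat.cast_nonneg _).trans hi.le
    calc 2 * (m i : ℝ) / F * r i ≤ 2 * x / F * x := by gcongr
      _ = 2 * x ^ 2 / F := by ring
  · exact hB

/-- Let `0 < d < 1/2` and `H ≤ S_n` with `|H| = 2`.  For each irreducible
unitary representation `ρ` of `S_n` let `Π_H^ρ = (1/2) Σ_{h∈H} ρ(h)` and
`P(ρ) = (2 d_ρ/n!)·rk Π_H^ρ` (the probability of observing `ρ` when weak Fourier sampling
the coset state of `H`).  Then for every `γ < 1 − 2d` and all sufficiently large `n`,
`Σ_{ρ : d_ρ < n^{dn}} P(ρ) < n^{−γn}`, the sum running over a complete family of pairwise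
non-isomorphic irreducible unitary representations of `S_n`. -/
theorem weak_fourier_sampling_small_dimension_unlikely
    (d γ : ℝ) (hd0 : 0 < d) (hd : d < 1 / 2) (hγ : γ < 1 - 2 * d) :
    ∃ N : ℕ, ∀ n ≥ N,
      ∀ H : Subgroup (Equiv.Perm (Fin n)), Nat.card H = 2 →
      ∀ (ι : Type) [Fintype ι] (V : ι → Type)
        [∀ i, NormedAddCommGroup (V i)] [∀ i, InnerProductSpace ℂ (V i)]
        [∀ i, FiniteDimensional ℂ (V i)]
        (ρ : ∀ i, Equiv.Perm (Fin n) →* (V i ≃ₗᵢ[ℂ] V i)),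
        (∀ i, ∀ W : Submodule ℂ (V i),
          (∀ g : Equiv.Perm (Fin n), ∀ v ∈ W, ρ i g v ∈ W) → W = ⊥ ∨ W = ⊤) →
        (∀ i j, i ≠ j → ∀ f : V i →ₗ[ℂ] V j,
          (∀ g x, f (ρ i g x) = ρ j g (f x)) → f = 0) →
        (∑ i, (Module.finrank ℂ (V i)) ^ 2 = n.factorial) →
        ∑ i ∈ Finset.univ.filter (fun i =>
              (Module.finrank ℂ (V i) : ℝ) < (n : ℝ) ^ (d * (n : ℝ))),
            2 * (Module.finrank ℂ (V i) : ℝ) / (n.factorial : ℝ) *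
              (Module.finrank ℂ (LinearMap.range ((Nat.card H : ℂ)⁻¹ •
                ∑ h : H, (((ρ i h).toLinearEquiv : V i →ₗ[ℂ] V i)))) : ℝ)
          < (n : ℝ) ^ (-(γ * (n : ℝ))) := by
  obtain ⟨N, hN⟩ := Filter.eventually_atTop.mp
    (eventually_two_pow_mul_rpow_sq_div_factorial_lt hγ)
  refine ⟨N, fun n hn H _ ι _ V _ _ _ ρ hirr hniso _ => ?_⟩
  refine lt_of_le_of_lt ?_ (hN n hn)
  have hcard := (card_filter_finrank_ne_zero_le_card_conjClasses V ρ hirr hniso).trans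
    (Equiv.Perm.card_conjClasses_le n)
  refine (sum_filter_lt_mul_div_le (fun i => Module.finrank ℂ (V i)) _
    (fun i => Submodule.finrank_le _) (Nat.cast_nonneg _)).trans ?_
  gcongr
  exact_mod_cast hcard
end
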